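/- arXiv:1806.00176 — 3 statements merged into one kernel-verified Lean document; each statement's English description precedes it below -/
import Mathlib

section
/- Let φ(z) = (1/√(2π))·exp(−z²/2) be the standard normal density, let c₁ = φ(5) and c₂ = φ(2), and for θ ∈ ℝ define ELBO(θ) = ∫_ℝ φ(z−θ)·log(r(z)/φ(z−θ)) dz where r(z) = 𝟙{z>0}·c₁·φ(z) + 𝟙{z≤0}·c₂·φ(z), and define Reparam(θ) = ∫_ℝ φ(ε)·(𝟙{ε+θ>0}·(−θ−ε) + 𝟙{ε+θ≤0}·(−θ−ε)) dε. Then ELBO is differentiable on ℝ and for every θ ∈ ℝ, ELBO′(θ) ≠ Reparam(θ). -/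
open MeasureTheory Real

/-- The standard normal density. -/
noncomputable def stdNormal (z : ℝ) : ℝ :=
  (1 / Real.sqrt (2 * Real.pi)) * Real.exp (-z ^ 2 / 2)

/-- The unnormalized posterior `r(z) = 𝟙{z>0}·c₁·φ(z) + 𝟙{z≤0}·c₂·φ(z)`
with `c₁ = φ(5)` and `c₂ = φ(2)`. -/
noncomputable def rPost (z : ℝ) : ℝ :=
  (if z > 0 then (1 : ℝ) else 0) * stdNormal 5 * stdNormal z +
  (if z ≤ 0 then (1 : ℝ) else 0) * stdNormal 2 * stdNormal z

/-- `ELBO(θ) = ∫ φ(z−θ)·log(r(z)/φ(z−θ)) dz`. -/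
noncomputable def elbo (θ : ℝ) : ℝ :=
  ∫ z : ℝ, stdNormal (z - θ) * Real.log (rPost z / stdNormal (z - θ))

/-- The naive reparameterization gradient. -/
noncomputable def reparam (θ : ℝ) : ℝ :=
  ∫ ε : ℝ, stdNormal ε *
    ((if ε + θ > 0 then (1 : ℝ) else 0) * (-θ - ε) +
     (if ε + θ ≤ 0 then (1 : ℝ) else 0) * (-θ - ε))

theorem stdNormal_pos (z : ℝ) : 0 < stdNormal z := by
  unfold stdNormal
  positivity

theorem continuous_stdNormal : Continuous stdNormal := by
  unfold stdNormal
  fun_prop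

theorem stdNormal_eq_exp_neg_mul_sq (z : ℝ) :
    stdNormal z = (1 / √(2 * π)) * exp (-(1 / 2) * z ^ 2) := by
  rw [stdNormal]
  ring_nf

theorem stdNormal_neg (z : ℝ) : stdNormal (-z) = stdNormal z := by
  simp [stdNormal]

theorem log_stdNormal (z : ℝ) : log (stdNormal z) = log (1 / √(2 * π)) - z ^ 2 / 2 := by
  rw [stdNormal, log_mul (by positivity) (exp_pos _).ne', log_exp]
  ring

theorem integrable_stdNormal : Integrable stdNormal := by
  rw [funext stdNormal_eq_exp_neg_mul_sq]
  exact (integrable_exp_neg_mul_sq (by norm_num)).const_mul _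

theorem integrable_mul_stdNormal : Integrable fun z ↦ z * stdNormal z := by
  refine ((integrable_mul_exp_neg_mul_sq (b := 1 / 2) (by norm_num)).const_mul
    (1 / √(2 * π))).congr (.of_forall fun z ↦ ?_)
  simp only [stdNormal_eq_exp_neg_mul_sq]
  ring

theorem integral_stdNormal : ∫ z, stdNormal z = 1 := by
  simp_rw [stdNormal_eq_exp_neg_mul_sq]
  rw [integral_const_mul, integral_gaussian, div_div_eq_mul_div, div_one, mul_comm π 2]
  exact one_div_mul_cancel (by positivity)

theorem integral_mul_stdNormal : ∫ z, z * stdNormal z = 0 := by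
  have h := integral_neg_eq_self (fun z ↦ z * stdNormal z) volume
  simp only [stdNormal_neg, neg_mul, integral_neg] at h
  linarith

theorem reparam_eq (θ : ℝ) : reparam θ = -θ := by
  have h : ∀ ε, stdNormal ε * ((if ε + θ > 0 then (1 : ℝ) else 0) * (-θ - ε) +
      (if ε + θ ≤ 0 then (1 : ℝ) else 0) * (-θ - ε)) =
      -θ * stdNormal ε - ε * stdNormal ε := by
    intro ε
    rcases lt_or_ge 0 (ε + θ) with h | h
    · simp only [gt_iff_lt, h, h.not_ge, if_true, if_false]
      ring
    · simp only [gt_iff_lt, h, h.not_gt, if_true, if_false]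
      ring
  rw [reparam, funext h, integral_sub (integrable_stdNormal.const_mul _)
    integrable_mul_stdNormal, integral_const_mul, integral_stdNormal, integral_mul_stdNormal]
  ring

theorem log_rPost_div_stdNormal (θ ε : ℝ) :
    log (rPost (ε + θ) / stdNormal ε) =
      -θ * ε - θ ^ 2 / 2 + log (stdNormal 5) +
        (log (stdNormal 2) - log (stdNormal 5)) * (Set.Iic (-θ)).indicator 1 ε := by
  have hp := stdNormal_pos
  rcases lt_or_ge 0 (ε + θ) with h | h
  · have h' : ε ∉ Set.Iic (-θ) := by
      simp only [Set.mem_Iic]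
      linarith
    simp only [rPost, gt_iff_lt, h, h.not_ge, if_true, if_false, one_mul, zero_mul, add_zero,
      Set.indicator_of_notMem h', mul_zero]
    rw [log_div (mul_pos (hp _) (hp _)).ne' (hp _).ne', log_mul (hp _).ne' (hp _).ne',
      log_stdNormal ε, log_stdNormal (ε + θ)]
    ring
  · have h' : ε ∈ Set.Iic (-θ) := by
      simp only [Set.mem_Iic]
      linarith
    simp only [rPost, gt_iff_lt, h, h.not_gt, if_true, if_false, one_mul, zero_mul, zero_add,
      Set.indicator_of_mem h', Pi.one_apply, mul_one]
    rw [log_div (mul_pos (hp _) (hp _)).ne' (hp _).ne', log_mul (hp _).ne' (hp _).ne',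
      log_stdNormal ε, log_stdNormal (ε + θ)]
    ring

theorem elbo_eq (θ : ℝ) :
    elbo θ = -θ ^ 2 / 2 + log (stdNormal 5) +
      (log (stdNormal 2) - log (stdNormal 5)) * ∫ ε in Set.Iic (-θ), stdNormal ε := by
  have h : ∀ ε, stdNormal (ε + θ - θ) * log (rPost (ε + θ) / stdNormal (ε + θ - θ)) =
      -θ * (ε * stdNormal ε) + (-θ ^ 2 / 2 + log (stdNormal 5)) * stdNormal ε +
        (log (stdNormal 2) - log (stdNormal 5)) * (Set.Iic (-θ)).indicator stdNormal ε := by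
    intro ε
    rw [add_sub_cancel_right, log_rPost_div_stdNormal]
    by_cases hε : ε ∈ Set.Iic (-θ)
    · simp only [Set.indicator_of_mem hε, Pi.one_apply]
      ring
    · simp only [Set.indicator_of_notMem hε]
      ring
  have h₁ := integrable_mul_stdNormal.const_mul (-θ)
  have h₂ := integrable_stdNormal.const_mul (-θ ^ 2 / 2 + log (stdNormal 5))
  have h₁₂ : Integrable fun ε ↦ -θ * (ε * stdNormal ε) +
      (-θ ^ 2 / 2 + log (stdNormal 5)) * stdNormal ε := h₁.add h₂
  have h₃ := (integrable_stdNormal.indicator (measurableSet_Iic (a := -θ))).const_mul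
    (log (stdNormal 2) - log (stdNormal 5))
  rw [elbo, ← integral_add_right_eq_self _ θ, funext h, integral_add h₁₂ h₃,
    integral_add h₁ h₂, integral_const_mul, integral_const_mul, integral_const_mul,
    integral_indicator measurableSet_Iic, integral_stdNormal, integral_mul_stdNormal]
  ring

theorem hasDerivAt_integral_Iic_stdNormal (x : ℝ) :
    HasDerivAt (fun x ↦ ∫ ε in Set.Iic x, stdNormal ε) (stdNormal x) x := by
  have h : (fun x ↦ ∫ ε in Set.Iic x, stdNormal ε) =
      fun x ↦ (∫ ε in Set.Iic 0, stdNormal ε) + ∫ ε in (0 : ℝ)..x, stdNormal ε := by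
    funext x
    rw [← intervalIntegral.integral_Iic_sub_Iic integrable_stdNormal.integrableOn
      integrable_stdNormal.integrableOn]
    ring
  rw [h]
  exact (continuous_stdNormal.integral_hasStrictDerivAt 0 x).hasDerivAt.const_add _

theorem hasDerivAt_elbo (θ : ℝ) :
    HasDerivAt elbo (-θ - 21 / 2 * stdNormal θ) θ := by
  have h₁ := (hasDerivAt_integral_Iic_stdNormal (-θ)).comp θ (hasDerivAt_neg θ)
  have h₂ := (((hasDerivAt_pow 2 θ).neg.div_const 2).add_const (log (stdNormal 5))).add
    (h₁.const_mul (log (stdNormal 2) - log (stdNormal 5)))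
  rw [funext elbo_eq]
  refine h₂.congr_deriv ?_
  rw [stdNormal_neg, log_stdNormal 2, log_stdNormal 5]
  norm_num
  ring

theorem elbo_deriv_ne_reparam :
    Differentiable ℝ elbo ∧ ∀ θ : ℝ, deriv elbo θ ≠ reparam θ := by
  refine ⟨fun θ ↦ (hasDerivAt_elbo θ).differentiableAt, fun θ ↦ ?_⟩
  rw [(hasDerivAt_elbo θ).deriv, reparam_eq]
  linarith [stdNormal_pos θ]
end

section
/- (Differentiation under integration with moving domain.) Let Ω ⊆ ℝⁿ and Θ ⊆ ℝ be open sets, and let ε̂ : Ω × Θ → ℝⁿ be twice continuously differentiable such that for each θ ∈ Θ the map ε̂(·,θ) : Ω → ℝⁿ is a C¹-diffeomorphism onto its image D_θ := ε̂(Ω,θ). Let f : ℝⁿ × ℝ → ℝ be differentiable with f(·,θ) Lebesgue integrable on D_θ for each θ ∈ Θ. Suppose there exists an integrable function g : Ω → ℝ such that |∂/∂θ ( f(ε̂(ω,θ),θ) · |det D_ω ε̂(ω,θ)| )| ≤ g(ω) for all θ ∈ Θ and ω ∈ Ω. Define the velocity field v(ε,θ) = (∂/∂θ) ε̂(ω,θ)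 evaluated at ω = ε̂(·,θ)⁻¹(ε). Then the map θ ↦ ∫_{D_θ} f(ε,θ) dε is differentiable on Θ, and its derivative equals ∫_{D_θ} ( ∂f/∂θ (ε,θ) + div_ε ( f(·,θ)·v(·,θ) )(ε) ) dε, where div_ε denotes the divergence in the variable ε, i.e., div_ε(F) = Σ_{i=1}^n ∂F_i/∂ε_i. -/
open MeasureTheory

section Jacobi

variable {E : Type*} [NormedAddCommGroup E] [NormedSpace ℝ E] [FiniteDimensional ℝ E]

theorem ContinuousLinearMap.differentiable_det :
    Differentiable ℝ (fun A : E →L[ℝ] E => A.det) := by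
  let b := Module.finBasis ℝ E
  have hentry (i j) : Differentiable ℝ
      (fun A : E →L[ℝ] E => LinearMap.toMatrix b b (A : E →ₗ[ℝ] E) i j) := by
    have h : Differentiable ℝ (fun A : E →L[ℝ] E =>
        LinearMap.toContinuousLinearMap (b.coord i) (A (b j))) := by fun_prop
    simpa [LinearMap.toMatrix_apply] using h
  have h : (fun A : E →L[ℝ] E => A.det) =
      fun A : E →L[ℝ] E => (LinearMap.toMatrix b b (A : E →ₗ[ℝ] E)).det := by
    ext A
    rw [LinearMap.det_toMatrix]
  rw [h]
  simp only [Matrix.det_apply]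
  fun_prop

theorem LinearMap.hasDerivAt_det_one_add_smul (M : E →ₗ[ℝ] E) :
    HasDerivAt (fun s : ℝ => LinearMap.det (1 + s • M)) (LinearMap.trace ℝ E M) 0 := by
  let b := Module.finBasis ℝ E
  have h (s : ℝ) := Matrix.det_one_add_smul s (LinearMap.toMatrix b b M)
  have hdet (s : ℝ) : LinearMap.det (1 + s • M) =
      (1 + s • LinearMap.toMatrix b b M).det := by
    rw [← LinearMap.det_toMatrix b, map_add, map_smul, LinearMap.toMatrix_one]
  simp only [hdet, h, LinearMap.trace_eq_matrix_trace ℝ b M]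
  have hq (p : Polynomial ℝ) := p.hasDerivAt (0 : ℝ)
  have hl := ((hasDerivAt_id (0 : ℝ)).const_mul (LinearMap.toMatrix b b M).trace).const_add 1
  convert! hl.add ((hq _).mul (hasDerivAt_pow 2 (0 : ℝ))) using 1
  simp

/-- **Jacobi's formula** for the derivative of a determinant along a curve of invertible maps. -/
theorem HasDerivAt.clm_det {A : ℝ → E →L[ℝ] E} {B : E →L[ℝ] E} {t : ℝ} (hA : HasDerivAt A B t)
    (e : E ≃L[ℝ] E) (he : (e : E →L[ℝ] E) = A t) :
    HasDerivAt (fun s => (A s).det)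
      ((A t).det * LinearMap.trace ℝ E ((e.symm : E →L[ℝ] E) ∘L B : E →L[ℝ] E)) t := by
  have hd := (ContinuousLinearMap.differentiable_det (A t)).hasFDerivAt
  have hline : HasDerivAt (fun s : ℝ => A t + s • B) B 0 := by
    simpa using ((hasDerivAt_id (0 : ℝ)).smul_const B).const_add (A t)
  have hdet : HasDerivAt (fun s : ℝ => (A t + s • B).det)
      (fderiv ℝ (fun A : E →L[ℝ] E => A.det) (A t) B) 0 :=
    hd.comp_hasDerivAt_of_eq (0 : ℝ) hline (by simp)
  have hfac (s : ℝ) : (A t + s • B).det =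
      (A t).det * LinearMap.det
        (1 + s • ((e.symm : E →L[ℝ] E) ∘L B : E →L[ℝ] E) : E →ₗ[ℝ] E) := by
    simp only [ContinuousLinearMap.det]
    rw [← LinearMap.det_comp, ← he]
    congr 1
    ext x
    simp
  simp only [hfac] at hdet
  have := hdet.unique ((LinearMap.hasDerivAt_det_one_add_smul _).const_mul _)
  rw [← this]
  exact hd.comp_hasDerivAt t hA

end Jacobi

theorem ContDiffAt.exists_mixed_partial {E F : Type*} [NormedAddCommGroup E] [NormedSpace ℝ E]
    [NormedAddCommGroup F] [NormedSpace ℝ F] {G : E × ℝ → F} {x : E} {t : ℝ}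
    (hG : ContDiffAt ℝ 2 G (x, t)) :
    ∃ B : E →L[ℝ] F, HasDerivAt (fun s => fderiv ℝ (fun y => G (y, s)) x) B t ∧
      HasFDerivAt (fun y => deriv (fun s => G (y, s)) t) B x := by
  have hdiff : ∀ᶠ p in nhds (x, t), DifferentiableAt ℝ G p := by
    filter_upwards [hG.eventually (by simp)] with p hp
    exact hp.differentiableAt (by simp)
  have hx : HasFDerivAt (fun y : E => (y, t)) (ContinuousLinearMap.inl ℝ E ℝ) x :=
    hasFDerivAt_prodMk_left x t
  have ht : HasDerivAt (fun s : ℝ => (x, s)) ((0 : E), (1 : ℝ)) t :=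
    (hasDerivAt_const t x).prodMk (hasDerivAt_id t)
  have hD : HasFDerivAt (fderiv ℝ G) (fderiv ℝ (fderiv ℝ G) (x, t)) (x, t) :=
    ((hG.fderiv_right (m := 1) (by norm_num)).differentiableAt (by simp)).hasFDerivAt
  have hsymm : IsSymmSndFDerivAt ℝ G (x, t) := hG.isSymmSndFDerivAt (by simp)
  refine ⟨(fderiv ℝ (fderiv ℝ G) (x, t) (0, 1)).comp (.inl ℝ E ℝ), ?_, ?_⟩
  · have h := (hD.comp_hasDerivAt t ht).clm_comp
      (hasDerivAt_const t (ContinuousLinearMap.inl ℝ E ℝ))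
    simp only [ContinuousLinearMap.comp_zero, add_zero] at h
    refine h.congr_of_eventuallyEq ?_
    filter_upwards [ht.continuousAt.eventually hdiff] with s hs
    exact (hs.hasFDerivAt.comp x (hasFDerivAt_prodMk_left x s)).fderiv
  · have h := (hD.comp x hx).clm_apply (hasFDerivAt_const ((0 : E), (1 : ℝ)) x)
    have h' := h.congr_of_eventuallyEq (f₁ := fun y => deriv (fun s => G (y, s)) t) <| by
      filter_upwards [hx.continuousAt.eventually hdiff] with y hy
      have hy' : HasDerivAt (fun s : ℝ => (y, s)) ((0 : E), (1 : ℝ)) t :=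
        (hasDerivAt_const t y).prodMk (hasDerivAt_id t)
      exact (hy.hasFDerivAt.comp_hasDerivAt t hy').deriv
    convert h' using 1
    ext u
    simp [hsymm.eq (0, 1) (u, 0)]

theorem sum_fderiv_mul_apply_single {ι : Type*} [Fintype ι] [DecidableEq ι]
    {f : (ι → ℝ) → ℝ} {v : (ι → ℝ) → ι → ℝ} {f' : (ι → ℝ) →L[ℝ] ℝ}
    {v' : (ι → ℝ) →L[ℝ] ι → ℝ} {x : ι → ℝ}
    (hf : HasFDerivAt f f' x) (hv : HasFDerivAt v v' x) :
    ∑ i, fderiv ℝ (fun y => f y * v y i) x (Pi.single i 1) =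
      f' (v x) + f x * LinearMap.trace ℝ (ι → ℝ) v' := by
  have h (i : ι) := (hf.mul (hasFDerivAt_pi'.1 hv i)).fderiv
  have hfv : f' (v x) = ∑ i, v x i * f' (Pi.single i 1) := by
    conv_lhs => rw [pi_eq_sum_univ' (v x), map_sum]
    simp [map_smul]
  rw [hfv, LinearMap.trace_eq_matrix_trace ℝ (Pi.basisFun ℝ ι), Matrix.trace, Finset.mul_sum,
    ← Finset.sum_add_distrib]
  refine Finset.sum_congr rfl fun i _ => ?_
  rw [show (fun y => f y * v y i) = f * fun y => v y i from rfl, h i]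
  simp
  ring

/-- The time derivative of an integrand pulled back along a moving parameterization. -/
theorem hasDerivAt_comp_mul_abs_det {ι : Type*} [Fintype ι] [DecidableEq ι]
    {φ ψ : (ι → ℝ) → ℝ → ι → ℝ} {f : (ι → ℝ) → ℝ → ℝ} {x : ι → ℝ} {t : ℝ}
    (hφ : ContDiffAt ℝ 2 (fun p : (ι → ℝ) × ℝ => φ p.1 p.2) (x, t))
    (hdet : (fderiv ℝ (fun y => φ y t) x).det ≠ 0)
    (hψ : ∀ᶠ y in nhds x, ψ (φ y t) t = y)
    (hf : DifferentiableAt ℝ (fun p : (ι → ℝ) × ℝ => f p.1 p.2) (φ x t, t)) :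
    HasDerivAt (fun s => f (φ x s) s * |(fderiv ℝ (fun y => φ y s) x).det|)
      (|(fderiv ℝ (fun y => φ y t) x).det| * (deriv (fun s => f (φ x t) s) t +
        ∑ i, fderiv ℝ (fun y => f y t * deriv (fun s => φ (ψ y t) s) t i) (φ x t)
          (Pi.single i 1))) t := by
  obtain ⟨B, hB, hV⟩ := hφ.exists_mixed_partial
  set e := (fderiv ℝ (fun y => φ y t) x).toContinuousLinearEquivOfDetNeZero hdet
  have he' : (e : (ι → ℝ) →L[ℝ] ι → ℝ) = fderiv ℝ (fun y => φ y t) x :=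
    ContinuousLinearMap.coe_toContinuousLinearEquivOfDetNeZero _ _
  have hstrict : HasStrictFDerivAt (fun y => φ y t) (e : (ι → ℝ) →L[ℝ] ι → ℝ) x := by
    rw [he']
    exact (hφ.comp x (contDiffAt_id.prodMk contDiffAt_const)).hasStrictFDerivAt (by simp)
  have hψ' := (hstrict.to_local_left_inverse (g := fun y => ψ y t) hψ).hasFDerivAt
  have hψx : ψ (φ x t) t = x := hψ.self_of_nhds
  have hv : HasFDerivAt (fun y => deriv (fun s => φ (ψ y t) s) t)
      (B ∘L (e.symm : (ι → ℝ) →L[ℝ] ι → ℝ)) (φ x t) :=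
    HasFDerivAt.comp (g := fun y => deriv (fun s => φ y s) t) (φ x t)
      (by rw [hψx]; exact hV) hψ'
  have hf' := hf.hasFDerivAt
  set L := fderiv ℝ (fun p : (ι → ℝ) × ℝ => f p.1 p.2) (φ x t, t)
  have hfx : HasFDerivAt (fun y => f y t) (L ∘L .inl ℝ (ι → ℝ) ℝ) (φ x t) :=
    hf'.comp (f := fun y => (y, t)) (φ x t) (hasFDerivAt_prodMk_left (φ x t) t)
  have hft : HasDerivAt (fun s => f (φ x t) s) (L (0, 1)) t :=
    hf'.comp_hasDerivAt t ((hasDerivAt_const t (φ x t)).prodMk (hasDerivAt_id t))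
  have hφt : HasDerivAt (fun s => φ x s) (deriv (fun s => φ x s) t) t :=
    DifferentiableAt.hasDerivAt <|
      (hφ.comp t (contDiffAt_const.prodMk contDiffAt_id)).differentiableAt (by simp)
  have hfφ : HasDerivAt (fun s => f (φ x s) s) (L (deriv (fun s => φ x s) t, 1)) t :=
    hf'.comp_hasDerivAt (f := fun s => (φ x s, s)) t (hφt.prodMk (hasDerivAt_id t))
  have habs := (hasDerivAt_abs hdet).comp t (hB.clm_det e he')
  convert! hfφ.mul habs using 1
  rw [sum_fderiv_mul_apply_single hfx hv, hft.deriv, hψx]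
  have hL : L (deriv (fun s => φ x s) t, 1) =
      (L ∘L .inl ℝ (ι → ℝ) ℝ) (deriv (fun s => φ x s) t) + L (0, 1) := by
    simp [← map_add]
  have htr : LinearMap.trace ℝ (ι → ℝ) (B ∘L (e.symm : (ι → ℝ) →L[ℝ] ι → ℝ) :) =
      LinearMap.trace ℝ (ι → ℝ) ((e.symm : (ι → ℝ) →L[ℝ] ι → ℝ) ∘L B :) :=
    LinearMap.trace_comp_comm' _ _
  rw [hL, htr, ← sign_mul_self]
  dsimp only [Function.comp_apply]
  rw [← sign_mul_self]
  ring

theorem aestronglyMeasurable_deriv_of_eventually {α : Type*} [MeasurableSpace α] {μ : Measure α}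
    {F : ℝ → α → ℝ} {t : ℝ} (hF : ∀ᶠ s in nhds t, AEStronglyMeasurable (F s) μ)
    (hdiff : ∀ᵐ a ∂μ, DifferentiableAt ℝ (F · a) t) :
    AEStronglyMeasurable (fun a => deriv (F · a) t) μ := by
  classical
  let S : ℝ → α → ℝ := fun s a =>
    if AEStronglyMeasurable (F s) μ then slope (F · a) t s else 0
  refine aestronglyMeasurable_of_tendsto_ae (nhdsWithin t {t}ᶜ) (f := S) (fun s => ?_) ?_
  · by_cases hs : AEStronglyMeasurable (F s) μ
    · simp only [S, if_pos hs, slope_def_field]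
      exact (hs.sub hF.self_of_nhds).mul_const _
    · simpa only [S, if_neg hs] using aestronglyMeasurable_const
  · filter_upwards [hdiff] with a ha
    refine ha.hasDerivAt.tendsto_slope.congr' ?_
    filter_upwards [hF.filter_mono nhdsWithin_le_nhds] with s hs
    simp only [S, if_pos hs]

/-- Differentiation under integration with moving domain (Flanders). -/
theorem diff_under_integral_moving_domain
    (n : ℕ)
    (Ω : Set (Fin n → ℝ)) (Θ : Set ℝ) (hΩ : IsOpen Ω) (hΘ : IsOpen Θ)
    -- the smooth parameterization of the moving domain
    (ehat : (Fin n → ℝ) → ℝ → (Fin n → ℝ))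
    (hC2 : ContDiffOn ℝ 2 (fun p : (Fin n → ℝ) × ℝ => ehat p.1 p.2) (Ω ×ˢ Θ))
    -- for each θ ∈ Θ, ehat(·,θ) is a C¹-diffeomorphism of Ω onto its image:
    -- it is injective with everywhere invertible Jacobian on Ω
    (hinj : ∀ θ ∈ Θ, Set.InjOn (fun ω => ehat ω θ) Ω)
    (hdet : ∀ θ ∈ Θ, ∀ ω ∈ Ω, (fderiv ℝ (fun ω' => ehat ω' θ) ω).det ≠ 0)
    -- ψ(·,θ) is the inverse of ehat(·,θ) on its image
    (ψ : (Fin n → ℝ) → ℝ → (Fin n → ℝ))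
    (hψ : ∀ θ ∈ Θ, ∀ ω ∈ Ω, ψ (ehat ω θ) θ = ω)
    -- the integrand
    (f : (Fin n → ℝ) → ℝ → ℝ)
    (hf : Differentiable ℝ (fun p : (Fin n → ℝ) × ℝ => f p.1 p.2))
    (hfint : ∀ θ ∈ Θ, IntegrableOn (fun ε => f ε θ) ((fun ω => ehat ω θ) '' Ω))
    -- the integrable dominating function
    (g : (Fin n → ℝ) → ℝ) (hg : IntegrableOn g Ω)
    (hdom : ∀ θ ∈ Θ, ∀ ω ∈ Ω,
      |deriv (fun t => f (ehat ω t) t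
          * |(fderiv ℝ (fun ω' => ehat ω' t) ω).det|) θ| ≤ g ω) :
    ∀ θ ∈ Θ,
      HasDerivAt (fun t => ∫ ε in (fun ω => ehat ω t) '' Ω, f ε t)
        (∫ ε in (fun ω => ehat ω θ) '' Ω,
          (deriv (fun t => f ε t) θ
            + ∑ i : Fin n, fderiv ℝ
                (fun ε' => f ε' θ * (deriv (fun t => ehat (ψ ε' θ) t) θ) i)
                ε (Pi.single i 1))) θ := by
  intro θ hθ
  set F : ℝ → (Fin n → ℝ) → ℝ := fun t ω =>
    f (ehat ω t) t * |(fderiv ℝ (fun ω' => ehat ω' t) ω).det| with hF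
  have hC2' {t ω} (ht : t ∈ Θ) (hω : ω ∈ Ω) :
      ContDiffAt ℝ 2 (fun p : (Fin n → ℝ) × ℝ => ehat p.1 p.2) (ω, t) :=
    hC2.contDiffAt ((hΩ.prod hΘ).mem_nhds ⟨hω, ht⟩)
  have hfd {t} (ht : t ∈ Θ) : ∀ ω ∈ Ω, HasFDerivWithinAt (fun ω' => ehat ω' t)
      (fderiv ℝ (fun ω' => ehat ω' t) ω) Ω ω := fun ω hω =>
    (((hC2' ht hω).comp (f := fun ω' => (ω', t)) ω
      (contDiffAt_id.prodMk contDiffAt_const)).differentiableAt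
        (by simp)).hasFDerivAt.hasFDerivWithinAt
  have hderiv {t ω} (ht : t ∈ Θ) (hω : ω ∈ Ω) :=
    hasDerivAt_comp_mul_abs_det (hC2' ht hω) (hdet t ht ω hω)
      (Filter.eventually_of_mem (hΩ.mem_nhds hω) (hψ t ht)) (hf (ehat ω t, t))
  have hFint {t} (ht : t ∈ Θ) : IntegrableOn (F t) Ω := by
    have := (integrableOn_image_iff_integrableOn_abs_det_fderiv_smul volume hΩ.measurableSet
      (hfd ht) (hinj t ht) (fun ε => f ε t)).1 (hfint t ht)
    simpa only [hF, smul_eq_mul, mul_comm] using this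
  have hmeas : AEStronglyMeasurable (fun ω => deriv (F · ω) θ) (volume.restrict Ω) :=
    aestronglyMeasurable_deriv_of_eventually
      (Filter.eventually_of_mem (hΘ.mem_nhds hθ) fun t ht => (hFint ht).aestronglyMeasurable)
      ((ae_restrict_iff' hΩ.measurableSet).2 (.of_forall fun ω hω =>
        (hderiv hθ hω).differentiableAt))
  have key := (hasDerivAt_integral_of_dominated_loc_of_deriv_le (μ := volume.restrict Ω)
    (F := F) (F' := fun t ω => deriv (F · ω) t) (hΘ.mem_nhds hθ)
    (Filter.eventually_of_mem (hΘ.mem_nhds hθ) fun t ht => (hFint ht).aestronglyMeasurable)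
    (hFint hθ) hmeas
    ((ae_restrict_iff' hΩ.measurableSet).2 (.of_forall fun ω hω t ht => hdom t ht ω hω)) hg
    ((ae_restrict_iff' hΩ.measurableSet).2 (.of_forall fun ω hω t ht =>
      (hderiv ht hω).differentiableAt.hasDerivAt))).2
  rw [integral_image_eq_integral_abs_det_fderiv_smul volume hΩ.measurableSet (hfd hθ) (hinj θ hθ)]
  simp only [smul_eq_mul]
  rw [setIntegral_congr_fun (g := fun ω => deriv (F · ω) θ) hΩ.measurableSet fun ω hω =>
      (hderiv hθ hω).deriv.symm]
  refine key.congr_of_eventuallyEq ?_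
  filter_upwards [hΘ.mem_nhds hθ] with t ht
  rw [integral_image_eq_integral_abs_det_fderiv_smul volume hΩ.measurableSet (hfd ht) (hinj t ht)]
  simp only [hF, smul_eq_mul, mul_comm]
end

section
/- Let Φ₁,…,Φ_L : ℝⁿ → ℝ be affine maps, each with nonzero linear part, and suppose the hyperplanes H_l = {ε : Φ_l(ε) = 0} are pairwise distinct as sets. For σ ∈ {−1,1} let S_{l,1} = {ε : Φ_l(ε) > 0} and S_{l,−1} = {ε : Φ_l(ε) ≤ 0}. Suppose {C_k}_{k=1,…,K} is a partition of ℝⁿ such that for every k there exists σ_k ∈ {−1,1}^L with C_k = ∩_{l=1}^L S_{l,(σ_k)_l}. Then for each l ∈ {1,…,L} and for μ_H^{n−1}-almost every ε ∈ H_l, there exist exactly two indices k with ε in the closure of C_k; moreover for these two indices, one has (σ_k)_l = 1 and the other has (σ_k)_l = −1. -/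
open MeasureTheory

/-- The intersection of two distinct hyperplanes of `ℝⁿ` is null for the `(n - 1)`-dimensional
Hausdorff measure. -/
theorem hausdorffMeasure_inter_hyperplanes_eq_zero {n : ℕ}
    {f g : EuclideanSpace ℝ (Fin n) →ᵃ[ℝ] ℝ} (hf : f.linear ≠ 0) (hg : g.linear ≠ 0)
    (hfg : {x | f x = 0} ≠ {x | g x = 0}) :
    (μH[n - 1] : Measure (EuclideanSpace ℝ (Fin n))) ({x | f x = 0} ∩ {x | g x = 0}) = 0 := by
  rcases Set.eq_empty_or_nonempty ({x | f x = 0} ∩ {x | g x = 0}) with h | ⟨p, hpf, hpg⟩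
  · simp [h]
  rw [Set.mem_ofPred_eq] at hpf hpg
  have apply_eq (h : EuclideanSpace ℝ (Fin n) →ᵃ[ℝ] ℝ) (hp : h p = 0) (x) :
      h x = h.linear (x - p) := by
    have := h.linearMap_vsub x p
    simpa [hp] using this.symm
  set W := f.linear.ker ⊓ g.linear.ker with hW
  have hfk := Module.Dual.finrank_ker_add_one_of_ne_zero (f := f.linear) hf
  have hgk := Module.Dual.finrank_ker_add_one_of_ne_zero (f := g.linear) hg
  have hlt : W < f.linear.ker := by
    refine lt_of_le_of_ne inf_le_left fun h => hfg ?_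
    have hker : f.linear.ker = g.linear.ker :=
      Submodule.eq_of_le_of_finrank_eq (inf_eq_left.mp h) (by omega)
    ext x
    have hx : x - p ∈ f.linear.ker ↔ x - p ∈ g.linear.ker := by rw [hker]
    simpa [apply_eq f hpf x, apply_eq g hpg x] using hx
  have hrank := Submodule.finrank_lt_finrank_of_lt hlt
  rw [finrank_euclideanSpace_fin] at hfk
  have hset : {x | f x = 0} ∩ {x | g x = 0} = (fun w => w + p) '' (W : Set _) := by
    ext x
    simp [apply_eq f hpf x, apply_eq g hpg x, hW, sub_eq_add_neg]
  have hdim : dimH ({x | f x = 0} ∩ {x | g x = 0}) = Module.finrank ℝ W := by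
    rw [hset, (isometry_add_right p).dimH_image, ← Real.dimH_univ_eq_finrank W,
      ← W.subtypeₗᵢ.isometry.dimH_image]
    simp
  have hn : ((n : ℝ) - 1) = ((n - 1 : ℕ) : NNReal) := by
    rw [NNReal.coe_natCast, Nat.cast_sub (by omega)]
    simp
  rw [hn]
  apply hausdorffMeasure_of_dimH_lt
  rw [hdim]
  norm_cast
  omega

/-- For a partition of `ℝⁿ` into cells cut out by `L` pairwise-distinct hyperplanes,
almost every point (w.r.t. `(n−1)`-dimensional Hausdorff measure) of each hyperplane
lies in the closure of exactly two cells, one on each side of that hyperplane. -/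
theorem boundary_point_in_exactly_two_cells
    (n L K : ℕ) (hn : 2 ≤ n)
    (Φ : Fin L → (EuclideanSpace ℝ (Fin n)) →ᵃ[ℝ] ℝ)
    (hΦ : ∀ l, (Φ l).linear ≠ 0)
    (hH_distinct : ∀ l l' : Fin L, l ≠ l' →
      {ε : EuclideanSpace ℝ (Fin n) | Φ l ε = 0} ≠ {ε | Φ l' ε = 0})
    (σ : Fin K → Fin L → ℤ) (hσ : ∀ k l, σ k l = 1 ∨ σ k l = -1)
    (C : Fin K → Set (EuclideanSpace ℝ (Fin n)))
    (hC : ∀ k, C k = ⋂ l, (if σ k l = 1 then {ε | Φ l ε > 0} else {ε | Φ l ε ≤ 0}))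
    (hC_disj : Pairwise (Function.onFun Disjoint C))
    (hC_cover : (⋃ k, C k) = Set.univ) :
    ∀ l : Fin L,
      ∀ᵐ ε ∂((μH[n - 1] : Measure (EuclideanSpace ℝ (Fin n))).restrict
          {ε | Φ l ε = 0}),
        ∃ k₁ k₂ : Fin K, k₁ ≠ k₂ ∧ σ k₁ l = 1 ∧ σ k₂ l = -1 ∧
          ε ∈ closure (C k₁) ∧ ε ∈ closure (C k₂) ∧
          ∀ k, ε ∈ closure (C k) → k = k₁ ∨ k = k₂ := by
  intro l
  have hmeas : ∀ l, MeasurableSet {ε | Φ l ε = 0} := fun l =>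
    (isClosed_eq (Φ l).continuous_of_finiteDimensional continuous_const).measurableSet
  have hae : ∀ᵐ ε ∂((μH[n - 1] : Measure (EuclideanSpace ℝ (Fin n))).restrict
      {ε | Φ l ε = 0}), ∀ l', l' ≠ l → Φ l' ε ≠ 0 := by
    refine ae_all_iff.2 fun l' => ?_
    by_cases h : l' = l
    · simp [h]
    · simp only [ne_eq, h, not_false_eq_true, forall_const, ae_iff, not_not]
      rw [Measure.restrict_apply (hmeas l')]
      exact hausdorffMeasure_inter_hyperplanes_eq_zero (hΦ l') (hΦ l) (hH_distinct l' l h)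
  filter_upwards [hae, ae_restrict_mem (hmeas l)] with ε hε hl
  have hmem : ∀ k x, x ∈ C k ↔ ∀ l, (σ k l = 1 ↔ 0 < Φ l x) := by
    intro k x
    rw [hC, Set.mem_iInter]
    refine forall_congr' fun l => ?_
    split_ifs with h <;> simp [h]
  have hcell : ∀ x, ∃ k, x ∈ C k := fun x =>
    Set.mem_iUnion.1 (hC_cover ▸ Set.mem_univ x)
  have hsign : ∀ᶠ x in nhds ε, ∀ l', l' ≠ l → (0 < Φ l' x ↔ 0 < Φ l' ε) := by
    refine Filter.eventually_all.2 fun l' => ?_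
    by_cases h : l' = l
    · simp [h]
    have hc := (Φ l').continuous_of_finiteDimensional.continuousAt (x := ε)
    rcases (hε l' h).lt_or_gt with h0 | h0
    · filter_upwards [hc.eventually_lt_const h0] with x hx _
      exact iff_of_false hx.not_gt h0.not_gt
    · filter_upwards [hc.eventually_const_lt h0] with x hx _
      exact iff_of_true hx h0
  have huniq : ∀ k k', σ k l = σ k' l → ε ∈ closure (C k) → ε ∈ closure (C k') → k = k' := by
    have key : ∀ k, ε ∈ closure (C k) →
        (C k).Nonempty ∧ ∀ l', l' ≠ l → (σ k l' = 1 ↔ 0 < Φ l' ε) := by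
      intro k hk
      obtain ⟨x, hx, hxk⟩ := ((mem_closure_iff_frequently.1 hk).and_eventually hsign).exists
      exact ⟨⟨x, hx⟩, fun l' h => ((hmem k x).1 hx l').trans (hxk l' h)⟩
    intro k k' hkk' hk hk'
    obtain ⟨⟨x, hx⟩, h1⟩ := key k hk
    obtain ⟨-, h2⟩ := key k' hk'
    by_contra hne
    refine Set.disjoint_left.1 (hC_disj hne) hx ((hmem k' x).2 fun l' => ?_)
    rw [← (hmem k x).1 hx l']
    by_cases h : l' = l
    · rw [h, hkk']
    · rw [h1 l' h, h2 l' h]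
  obtain ⟨v, hv⟩ : ∃ v, 0 < (Φ l).linear v := by
    obtain ⟨v, hv⟩ := DFunLike.ne_iff.1 (hΦ l)
    rcases (show (Φ l).linear v ≠ 0 from hv).lt_or_gt with h | h
    · exact ⟨-v, by simpa using h⟩
    · exact ⟨v, h⟩
  have hlim : Filter.Tendsto (fun t : ℝ => t • v + ε) (nhdsWithin 0 (Set.Ioi 0)) (nhds ε) := by
    have : Continuous fun t : ℝ => t • v + ε := by fun_prop
    simpa using (this.tendsto 0).mono_left nhdsWithin_le_nhds
  have hpos : ∀ᶠ t : ℝ in nhdsWithin 0 (Set.Ioi 0), 0 < Φ l (t • v + ε) := by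
    filter_upwards [self_mem_nhdsWithin] with t ht
    have := (Φ l).map_vadd ε (t • v)
    simp only [vadd_eq_add, hl, map_smul, smul_eq_mul, add_zero] at this
    rw [this]
    exact mul_pos ht hv
  have hside := (hlim.eventually hsign).and hpos
  obtain ⟨t, ht, htpos⟩ := hside.exists
  obtain ⟨k₁, hk₁⟩ := hcell (t • v + ε)
  obtain ⟨k₂, hk₂⟩ := hcell ε
  have hσ₁ : σ k₁ l = 1 := ((hmem _ _).1 hk₁ l).2 htpos
  have hσ₂ : σ k₂ l = -1 := (hσ k₂ l).resolve_left fun h => by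
    simpa [hl] using ((hmem _ _).1 hk₂ l).1 h
  have hcl₁ : ε ∈ closure (C k₁) := by
    refine mem_closure_of_tendsto hlim ?_
    filter_upwards [hside] with s hs
    refine (hmem _ _).2 fun l' => ?_
    by_cases h : l' = l
    · subst h
      simp [hσ₁, hs.2]
    · rw [(hmem _ _).1 hk₁ l', ht l' h, hs.1 l' h]
  have hcl₂ := subset_closure hk₂
  refine ⟨k₁, k₂, ?_, hσ₁, hσ₂, hcl₁, hcl₂, fun k hk => ?_⟩
  · rintro rfl
    omega
  · exact (hσ k l).imp (fun h => huniq _ _ (h.trans hσ₁.symm) hk hcl₁)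
      (fun h => huniq _ _ (h.trans hσ₂.symm) hk hcl₂)
end
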